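/- The progression angle Λ^Θ(C₂) is monotonically decreasing with respect to C₂ on the interval (3·4^{1/3}, ∞), and π < Λ^Θ(C₂) < √2·π for every C₂ > 3·4^{1/3}. -/

import Mathlib

/-- The complete elliptic integral of the third kind
`Π(n, m) = ∫₀^{π/2} dθ / ((1 - n sin²θ)·√(1 - m sin²θ))`. -/
noncomputable def ellipticPi (n m : ℝ) : ℝ :=
  ∫ θ in (0 : ℝ)..(Real.pi / 2),
    1 / ((1 - n * Real.sin θ ^ 2) * Real.sqrt (1 - m * Real.sin θ ^ 2))

/-- Half the sum of the two positive roots of `u³ - u + ε`, as a function of half their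
difference `d`. -/
noncomputable def rootMean (d : ℝ) : ℝ := √((1 - d ^ 2) / 3)

theorem rootMean_facts {d y : ℝ} (hd : d ∈ Set.Ioo (-1 / 2 : ℝ) (1 / 2)) (hy : |y| ≤ 1) :
    1 / 2 < rootMean d ∧ 3 * rootMean d ^ 2 + d ^ 2 = 1 ∧
      0 < rootMean d + d * y ∧ rootMean d + d * y < 1 := by
  obtain ⟨h1, h2⟩ := hd
  have hd2 : d ^ 2 < 1 / 4 := by nlinarith
  have hs2 : rootMean d ^ 2 = (1 - d ^ 2) / 3 := Real.sq_sqrt (by linarith)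
  have hs : 1 / 2 < rootMean d := Real.lt_sqrt_of_sq_lt (by linarith)
  have hdy : |d * y| ≤ |d| := by
    rw [abs_mul]; exact mul_le_of_le_one_right (abs_nonneg d) hy
  have hda : |d| < 1 / 2 := by rw [abs_lt]; constructor <;> linarith
  have hlt : rootMean d < 1 - |d| := by
    refine lt_of_pow_lt_pow_left₀ 2 (by linarith) ?_
    nlinarith [sq_abs d, abs_nonneg d]
  have := abs_le.1 hdy
  exact ⟨hs, by linarith, by linarith, by linarith⟩

theorem hasDerivAt_rootMean {d : ℝ} (hd : d ∈ Set.Ioo (-1 / 2 : ℝ) (1 / 2)) :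
    HasDerivAt rootMean (-d / (3 * rootMean d)) d := by
  have hd2 : d ^ 2 < 1 / 4 := by nlinarith [hd.1, hd.2]
  have h : HasDerivAt (fun x : ℝ => (1 - x ^ 2) / 3) (-(2 * d) / 3) d := by
    simpa using (((hasDerivAt_id d).pow 2).const_sub 1).div_const 3
  have hs := (rootMean_facts hd (y := 0) (by simp)).1
  refine (h.sqrt (by linarith)).congr_deriv ?_
  rw [show √((1 - d ^ 2) / 3) = rootMean d from rfl]
  field_simp

theorem angle_polynomial_identity {s d y e u k : ℝ} (h : 3 * s ^ 2 + d ^ 2 = 1)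
    (he : e = 2 * s * (4 * s ^ 2 - 1)) (hu : u = s + d * y) (hk : k = 12 * s ^ 2 - 1) :
    d * (6 * s * k) * (2 * (-(24 * s ^ 2 - 2) * d) * (1 - u ^ 2) * (u + 2 * s)
      + 8 * e * u * (3 * s * y - d) * (u + 2 * s) - 2 * e * (1 - u ^ 2) * (3 * s * y - 3 * d)) =
    3 * s * d * ((2 * y * ((u + 2 * s) * (18 * e * u + 4) - 12 * e)
        - 2 * d * (1 - y ^ 2) * (18 * e * u + 4 + 18 * e * (u + 2 * s))) * ((1 - u ^ 2) * (u + 2 * s))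
      + 2 * d * (1 - y ^ 2) * ((u + 2 * s) * (18 * e * u + 4) - 12 * e) *
        (-2 * u * (u + 2 * s) + (1 - u ^ 2) / 2))
    - 3 * s * (2 * (2 - 9 * e * u) * (1 - u ^ 2) ^ 2 * (u + 2 * s)) := by
  subst he hu hk
  grind

/-- The constant term `ε` of the cubic `u³ - u + ε` whose positive roots differ by `2 d`. -/
noncomputable def rootProduct (d : ℝ) : ℝ := 2 * rootMean d * (4 * rootMean d ^ 2 - 1)

/-- The point between the two positive roots of `u³ - u + ε` with phase `θ`. -/
noncomputable def orbit (d θ : ℝ) : ℝ := rootMean d + d * Real.cos (2 * θ)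

/-- The integrand of the progression angle in the phase variable. -/
noncomputable def angleIntegrand (d θ : ℝ) : ℝ :=
  4 * √(rootProduct d) / ((1 - orbit d θ ^ 2) * √(orbit d θ + 2 * rootMean d))

/-- The derivative of `angleIntegrand d θ` in `d`. -/
noncomputable def angleIntegrandDeriv (d θ : ℝ) : ℝ :=
  (2 * (-(24 * rootMean d ^ 2 - 2) * d) * (1 - orbit d θ ^ 2) * (orbit d θ + 2 * rootMean d)
      + 8 * rootProduct d * orbit d θ * (3 * rootMean d * Real.cos (2 * θ) - d)
        * (orbit d θ + 2 * rootMean d)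
      - 2 * rootProduct d * (1 - orbit d θ ^ 2) * (3 * rootMean d * Real.cos (2 * θ) - 3 * d)) /
    (3 * rootMean d * (√(rootProduct d) * √(orbit d θ + 2 * rootMean d) ^ 3
      * (1 - orbit d θ ^ 2) ^ 2))

/-- A function of `θ`, vanishing at `0` and `π / 2`, whose derivative agrees with
`angleIntegrandDeriv d` up to a term with positive integral. -/
noncomputable def anglePrimitive (d θ : ℝ) : ℝ :=
  Real.sin (2 * θ) * ((orbit d θ + 2 * rootMean d) * (18 * rootProduct d * orbit d θ + 4)
      - 12 * rootProduct d) /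
    (6 * rootMean d * (12 * rootMean d ^ 2 - 1) * √(rootProduct d)
      * ((1 - orbit d θ ^ 2) * √(orbit d θ + 2 * rootMean d)))

theorem orbit_facts {d : ℝ} (hd : d ∈ Set.Ioo (-1 / 2 : ℝ) (1 / 2)) (θ : ℝ) :
    1 / 2 < rootMean d ∧ 0 < orbit d θ ∧ orbit d θ < 1 ∧ 0 < rootProduct d ∧
      0 < 1 - orbit d θ ^ 2 := by
  obtain ⟨h1, -, h3, h4⟩ := rootMean_facts hd (Real.abs_cos_le_one (2 * θ))
  refine ⟨h1, h3, h4, ?_, ?_⟩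
  · have : 0 < 4 * rootMean d ^ 2 - 1 := by nlinarith
    unfold rootProduct; positivity
  · change 0 < 1 - (rootMean d + d * Real.cos (2 * θ)) ^ 2
    nlinarith

theorem hasDerivAt_rootProduct {d : ℝ} (hd : d ∈ Set.Ioo (-1 / 2 : ℝ) (1 / 2)) :
    HasDerivAt rootProduct (-(24 * rootMean d ^ 2 - 2) * d / (3 * rootMean d)) d := by
  have hs := (orbit_facts hd 0).1
  have h := hasDerivAt_rootMean hd
  refine ((h.const_mul 2).mul (((h.pow 2).const_mul 4).sub_const 1)).congr_deriv ?_
  simp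
  field_simp
  ring

theorem hasDerivAt_angleIntegrand {d : ℝ} (hd : d ∈ Set.Ioo (-1 / 2 : ℝ) (1 / 2)) (θ : ℝ) :
    HasDerivAt (fun x => angleIntegrand x θ) (angleIntegrandDeriv d θ) d := by
  obtain ⟨hs, hu0, hu1, hE, hM⟩ := orbit_facts hd θ
  have h := hasDerivAt_rootMean hd
  have hu : HasDerivAt (fun x => orbit x θ) (-d / (3 * rootMean d) + 1 * Real.cos (2 * θ)) d :=
    h.add ((hasDerivAt_id d).mul_const _)
  have hw := (hu.add (h.const_mul 2)).sqrt (by simp only [Pi.add_apply]; positivity)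
  have hE' := (hasDerivAt_rootProduct hd).sqrt hE.ne'
  have hw0 : 0 < √(orbit d θ + 2 * rootMean d) := by positivity
  have hE0 : 0 < √(rootProduct d) := by positivity
  refine ((hE'.const_mul 4).div (((hu.pow 2).const_sub 1).mul hw)
    (by simp only [Pi.mul_apply]; positivity)).congr_deriv ?_
  have e1 : rootProduct d = √(rootProduct d) ^ 2 := (Real.sq_sqrt hE.le).symm
  have e2 : orbit d θ + 2 * rootMean d = √(orbit d θ + 2 * rootMean d) ^ 2 :=
    (Real.sq_sqrt (by positivity)).symm
  simp only [Pi.mul_apply, Pi.pow_apply, angleIntegrandDeriv]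
  generalize √(rootProduct d) = E at *
  generalize √(orbit d θ + 2 * rootMean d) = w at *
  rw [e1, e2]
  have := hM.ne'
  generalize orbit d θ = u at *
  simp
  field_simp
  ring

theorem hasDerivAt_anglePrimitive {d : ℝ} (hd : d ∈ Set.Ioo (0 : ℝ) (1 / 2)) (θ : ℝ) :
    HasDerivAt (anglePrimitive d) (angleIntegrandDeriv d θ +
      (2 - 9 * rootProduct d * orbit d θ) / √(orbit d θ + 2 * rootMean d) /
        (3 * rootMean d * d * (12 * rootMean d ^ 2 - 1) * √(rootProduct d))) θ := by
  have hd' : d ∈ Set.Ioo (-1 / 2 : ℝ) (1 / 2) := ⟨by linarith [hd.1], hd.2⟩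
  obtain ⟨hs, hu0, hu1, hE, hM⟩ := orbit_facts hd' θ
  have hd0 : d ≠ 0 := hd.1.ne'
  have h3 := (rootMean_facts hd' (Real.abs_cos_le_one (2 * θ))).2.1
  have hk : 0 < 12 * rootMean d ^ 2 - 1 := by nlinarith
  have h2 : HasDerivAt (fun θ : ℝ => 2 * θ) 2 θ := by simpa using (hasDerivAt_id θ).const_mul 2
  have hu : HasDerivAt (orbit d) (d * (-Real.sin (2 * θ) * 2)) θ :=
    (h2.cos.const_mul d).const_add _
  have hu2 := hu.add_const (2 * rootMean d)
  have hw := hu2.sqrt (by positivity)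
  have hw0 : 0 < √(orbit d θ + 2 * rootMean d) := by positivity
  have hE0 : 0 < √(rootProduct d) := by positivity
  refine ((h2.sin.mul ((hu2.mul ((hu.const_mul (18 * rootProduct d)).add_const 4)).sub_const
    (12 * rootProduct d))).div ((((hu.pow 2).const_sub 1).mul hw).const_mul
      (6 * rootMean d * (12 * rootMean d ^ 2 - 1) * √(rootProduct d)))
    (by simp only [Pi.mul_apply]; positivity)).congr_deriv ?_
  have key := angle_polynomial_identity (y := Real.cos (2 * θ)) h3 (e := rootProduct d) rfl
    (u := orbit d θ) rfl rfl
  have e1 : rootProduct d = √(rootProduct d) ^ 2 := (Real.sq_sqrt hE.le).symm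
  have e2 : orbit d θ + 2 * rootMean d = √(orbit d θ + 2 * rootMean d) ^ 2 :=
    (Real.sq_sqrt (by positivity)).symm
  have hv := Real.sin_sq (2 * θ)
  simp only [Pi.mul_apply, Pi.pow_apply, angleIntegrandDeriv]
  have hM' := hM.ne'
  have hk' := hk.ne'
  generalize √(rootProduct d) = E at *
  generalize √(orbit d θ + 2 * rootMean d) = w at *
  generalize Real.sin (2 * θ) = v at *
  generalize Real.cos (2 * θ) = y at *
  rw [← hv, e2] at key
  rw [e2]
  generalize rootProduct d = e at *
  generalize orbit d θ = u at *
  generalize rootMean d = s at *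
  subst e1
  generalize hkk : 12 * s ^ 2 - 1 = k at *
  have hs0 : s ≠ 0 := by positivity
  generalize hm : 1 - u ^ 2 = m at *
  simp
  field_simp
  apply mul_left_cancel₀ hs0
  linear_combination -key

theorem continuousOn_rootMean : ContinuousOn rootMean (Set.Ioo (-1 / 2 : ℝ) (1 / 2)) :=
  fun _ hd => (hasDerivAt_rootMean hd).continuousAt.continuousWithinAt

theorem continuousOn_angleIntegrandDeriv :
    ContinuousOn (fun p : ℝ × ℝ => angleIntegrandDeriv p.1 p.2)
      (Set.Ioo (-1 / 2 : ℝ) (1 / 2) ×ˢ Set.univ) := by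
  have hs : ContinuousOn (fun p : ℝ × ℝ => rootMean p.1)
      (Set.Ioo (-1 / 2 : ℝ) (1 / 2) ×ˢ Set.univ) :=
    continuousOn_rootMean.comp continuousOn_fst fun p hp => hp.1
  have hu : ContinuousOn (fun p : ℝ × ℝ => orbit p.1 p.2)
      (Set.Ioo (-1 / 2 : ℝ) (1 / 2) ×ˢ Set.univ) :=
    hs.add (by fun_prop)
  have he : ContinuousOn (fun p : ℝ × ℝ => rootProduct p.1)
      (Set.Ioo (-1 / 2 : ℝ) (1 / 2) ×ˢ Set.univ) := by
    unfold rootProduct; fun_prop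
  unfold angleIntegrandDeriv
  refine ContinuousOn.div (by fun_prop) (by fun_prop) ?_
  rintro ⟨d, θ⟩ ⟨hd, -⟩
  obtain ⟨h1, h2, -, h4, h5⟩ := orbit_facts hd θ
  simp only
  positivity

theorem continuous_orbit (d : ℝ) : Continuous (orbit d) := by
  unfold orbit; fun_prop

theorem continuous_angleIntegrand {d : ℝ} (hd : d ∈ Set.Ioo (-1 / 2 : ℝ) (1 / 2)) :
    Continuous (angleIntegrand d) := by
  have := continuous_orbit d
  unfold angleIntegrand
  refine Continuous.div (by fun_prop) (by fun_prop) fun θ => ?_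
  obtain ⟨h1, h2, -, h4, h5⟩ := orbit_facts hd θ
  positivity

theorem continuous_angleIntegrandDeriv {d : ℝ} (hd : d ∈ Set.Ioo (-1 / 2 : ℝ) (1 / 2)) :
    Continuous (angleIntegrandDeriv d) :=
  show Continuous ((fun p : ℝ × ℝ => angleIntegrandDeriv p.1 p.2) ∘ fun θ => (d, θ)) from
    continuousOn_angleIntegrandDeriv.comp_continuous (by fun_prop) fun _ => ⟨hd, trivial⟩

/-- The progression angle as a function of half the difference `d` of the rescaled roots. -/
noncomputable def angle (d : ℝ) : ℝ := ∫ θ in (0 : ℝ)..(Real.pi / 2), angleIntegrand d θ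

theorem hasDerivAt_angle {d : ℝ} (hd : d ∈ Set.Ioo (-1 / 2 : ℝ) (1 / 2)) :
    HasDerivAt angle (∫ θ in (0 : ℝ)..(Real.pi / 2), angleIntegrandDeriv d θ) d := by
  obtain ⟨l, r, hmem, hnhds, hsub⟩ := exists_Icc_mem_subset_of_mem_nhds (isOpen_Ioo.mem_nhds hd)
  obtain ⟨M, hM⟩ := (isCompact_Icc.prod isCompact_uIcc).exists_bound_of_continuousOn
    (continuousOn_angleIntegrandDeriv.mono
      (Set.prod_mono hsub (Set.subset_univ (Set.uIcc 0 (Real.pi / 2)))))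
  refine (intervalIntegral.hasDerivAt_integral_of_dominated_loc_of_deriv_le
    (bound := fun _ => M) hnhds ?_ ((continuous_angleIntegrand hd).intervalIntegrable _ _)
    (continuous_angleIntegrandDeriv hd).aestronglyMeasurable ?_ (by simp) ?_).2
  · filter_upwards [isOpen_Ioo.mem_nhds hd] with x hx
    exact (continuous_angleIntegrand hx).aestronglyMeasurable
  · exact .of_forall fun θ hθ x hx => hM (x, θ) ⟨hx, Set.uIoc_subset_uIcc hθ⟩
  · exact .of_forall fun θ _ x hx => hasDerivAt_angleIntegrand (hsub hx) θ

theorem integral_residual_pos {d : ℝ} (hd : d ∈ Set.Ioo (0 : ℝ) (1 / 2)) :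
    0 < ∫ θ in (0 : ℝ)..(Real.pi / 2),
      (2 - 9 * rootProduct d * orbit d θ) / √(orbit d θ + 2 * rootMean d) := by
  have hd' : d ∈ Set.Ioo (-1 / 2 : ℝ) (1 / 2) := ⟨by linarith [hd.1], hd.2⟩
  have h3 := (rootMean_facts hd' (y := 0) (by simp)).2.1
  obtain ⟨hs, -, -, he, -⟩ := orbit_facts hd' 0
  have hes : 0 < 2 - 9 * rootProduct d * rootMean d := by
    have : 0 < d ^ 2 := by have := hd.1; positivity
    unfold rootProduct; nlinarith
  have hcos : ∫ θ in (0 : ℝ)..(Real.pi / 2), Real.cos (2 * θ) = 0 := by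
    rw [intervalIntegral.integral_comp_mul_left _ two_ne_zero, integral_cos]
    simp [mul_div_cancel₀]
  have hval : ∫ θ in (0 : ℝ)..(Real.pi / 2), ((2 - 9 * rootProduct d * rootMean d) / 2 -
      9 * rootProduct d * d / √(3 * rootMean d) * Real.cos (2 * θ)) =
      Real.pi / 2 * ((2 - 9 * rootProduct d * rootMean d) / 2) := by
    rw [intervalIntegral.integral_sub (by simp)
      (by apply Continuous.intervalIntegrable; fun_prop),
      intervalIntegral.integral_const_mul, hcos]
    simp
    ring
  have hpos : 0 < Real.pi / 2 * ((2 - 9 * rootProduct d * rootMean d) / 2) := by positivity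
  rw [← hval] at hpos
  refine hpos.trans_le (intervalIntegral.integral_mono_on (by positivity)
    (by apply Continuous.intervalIntegrable; fun_prop) ?_ fun θ _ => ?_)
  · have := continuous_orbit d
    refine (Continuous.div (by fun_prop) (by fun_prop) fun θ => ?_).intervalIntegrable _ _
    obtain ⟨-, h, -⟩ := orbit_facts hd' θ
    positivity
  · obtain ⟨-, hu0, hu1, -⟩ := orbit_facts hd' θ
    have hdc : d * Real.cos (2 * θ) = orbit d θ - rootMean d := by unfold orbit; ring
    have hw2 : √(orbit d θ + 2 * rootMean d) ^ 2 = orbit d θ + 2 * rootMean d :=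
      Real.sq_sqrt (by positivity)
    have hz2 : √(3 * rootMean d) ^ 2 = 3 * rootMean d := Real.sq_sqrt (by positivity)
    have hw0 : 0 < √(orbit d θ + 2 * rootMean d) := by positivity
    have hz0 : 0 < √(3 * rootMean d) := by positivity
    have hs1 : rootMean d < 1 := by nlinarith
    have hw : √(orbit d θ + 2 * rootMean d) ≤ 2 := by nlinarith
    rw [show 9 * rootProduct d * d / √(3 * rootMean d) * Real.cos (2 * θ) =
      9 * rootProduct d * ((orbit d θ - rootMean d) / √(3 * rootMean d)) by rw [← hdc]; ring]
    generalize √(orbit d θ + 2 * rootMean d) = w at *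
    generalize √(3 * rootMean d) = z at *
    have h1 : (2 - 9 * rootProduct d * rootMean d) / 2 ≤
        (2 - 9 * rootProduct d * rootMean d) / w := by gcongr
    have hcov : (orbit d θ - rootMean d) / w ≤ (orbit d θ - rootMean d) / z := by
      rw [div_le_div_iff₀ hw0 hz0, show orbit d θ - rootMean d = w ^ 2 - z ^ 2 by linarith]
      nlinarith [mul_nonneg (sq_nonneg (w - z)) (add_pos hw0 hz0).le]
    have h2 := mul_le_mul_of_nonneg_left hcov (by positivity : 0 ≤ 9 * rootProduct d)
    have h4 : (2 - 9 * rootProduct d * orbit d θ) / w = (2 - 9 * rootProduct d * rootMean d) / w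
      - 9 * rootProduct d * ((orbit d θ - rootMean d) / w) := by ring
    rw [h4]
    linarith

theorem deriv_angle_neg {d : ℝ} (hd : d ∈ Set.Ioo (0 : ℝ) (1 / 2)) : deriv angle d < 0 := by
  have hd' : d ∈ Set.Ioo (-1 / 2 : ℝ) (1 / 2) := ⟨by linarith [hd.1], hd.2⟩
  have h3 := (rootMean_facts hd' (y := 0) (by simp)).2.1
  obtain ⟨hs, -, -, he, -⟩ := orbit_facts hd' 0
  have hk : 0 < 12 * rootMean d ^ 2 - 1 := by nlinarith
  have hd0 := hd.1
  rw [(hasDerivAt_angle hd').deriv]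
  have hc : Continuous fun θ => (2 - 9 * rootProduct d * orbit d θ) /
      √(orbit d θ + 2 * rootMean d) := by
    have := continuous_orbit d
    refine Continuous.div (by fun_prop) (by fun_prop) fun θ => ?_
    obtain ⟨-, h, -⟩ := orbit_facts hd' θ
    positivity
  have hf := continuous_angleIntegrandDeriv hd'
  have h := intervalIntegral.integral_eq_sub_of_hasDerivAt (a := 0) (b := Real.pi / 2)
    (fun θ _ => hasDerivAt_anglePrimitive hd θ)
    ((hf.add (hc.div_const _)).intervalIntegrable _ _)
  rw [intervalIntegral.integral_add (hf.intervalIntegrable _ _)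
    ((hc.div_const _).intervalIntegrable _ _), intervalIntegral.integral_div] at h
  have hend : anglePrimitive d (Real.pi / 2) - anglePrimitive d 0 = 0 := by
    simp [anglePrimitive, mul_div_cancel₀]
  have := div_pos (integral_residual_pos hd)
    (by positivity : 0 < 3 * rootMean d * d * (12 * rootMean d ^ 2 - 1) * √(rootProduct d))
  linarith

theorem strictAntiOn_angle : StrictAntiOn angle (Set.Ico 0 (1 / 2)) := by
  refine strictAntiOn_of_deriv_neg (convex_Ico _ _) (fun d hd => ?_) fun d hd => ?_
  · exact (hasDerivAt_angle ⟨by linarith [hd.1], hd.2⟩).continuousAt.continuousWithinAt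
  · rw [interior_Ico] at hd
    exact deriv_angle_neg hd

theorem angle_zero : angle 0 = √2 * Real.pi := by
  have h3 := (rootMean_facts (d := 0) (by norm_num) (y := 0) (by simp)).2.1
  have hs := (rootMean_facts (d := 0) (by norm_num) (y := 0) (by simp)).1
  have h : ∀ θ, angleIntegrand 0 θ = 2 * √2 := fun θ => by
    have hu : orbit 0 θ = rootMean 0 := by simp [orbit]
    have hq : √(rootProduct 0) = √2 / 3 * √(rootMean 0 + 2 * rootMean 0) := by
      rw [show √2 / 3 = √(2 / 9) by
        rw [Real.sqrt_div (by norm_num), show (9 : ℝ) = 3 ^ 2 by norm_num,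
          Real.sqrt_sq (by norm_num)],
        ← Real.sqrt_mul (by norm_num), rootProduct]
      congr 1
      nlinarith
    have hw : 0 < √(rootMean 0 + 2 * rootMean 0) := by positivity
    rw [angleIntegrand, hu, hq, show 1 - rootMean 0 ^ 2 = 2 / 3 by linarith]
    field_simp
    norm_num
  simp [angle, h]
  ring

theorem integral_inv_sub_mul_cos {A d : ℝ} (hA : |d| < A) :
    ∫ θ in (0 : ℝ)..(Real.pi / 2), 1 / (A - d * Real.cos (2 * θ)) =
      Real.pi / (2 * √(A ^ 2 - d ^ 2)) := by
  have hA0 := (abs_nonneg d).trans_lt hA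
  have hq : 0 < A ^ 2 - d ^ 2 := by
    rw [← sq_abs d]; nlinarith [abs_nonneg d]
  have hq0 : 0 < √(A ^ 2 - d ^ 2) := by positivity
  have hq2 : √(A ^ 2 - d ^ 2) ^ 2 = A ^ 2 - d ^ 2 := Real.sq_sqrt hq.le
  have hpos : ∀ θ, 0 < A - d * Real.cos (2 * θ) := fun θ => by
    have h := le_abs_self (d * Real.cos (2 * θ))
    rw [abs_mul] at h
    nlinarith [mul_le_of_le_one_right (abs_nonneg d) (Real.abs_cos_le_one (2 * θ))]
  have hderiv : ∀ θ ∈ Set.uIcc 0 (Real.pi / 2), HasDerivAt (fun θ => (θ + Real.arctan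
      (d * Real.sin (2 * θ) / (A - d * Real.cos (2 * θ) + √(A ^ 2 - d ^ 2)))) /
        √(A ^ 2 - d ^ 2)) (1 / (A - d * Real.cos (2 * θ))) θ := fun θ _ => by
    have h2 : HasDerivAt (fun θ : ℝ => 2 * θ) 2 θ := by simpa using (hasDerivAt_id θ).const_mul 2
    have hp := hpos θ
    have hden : A - d * Real.cos (2 * θ) + √(A ^ 2 - d ^ 2) ≠ 0 := by positivity
    refine (((hasDerivAt_id θ).add (((h2.sin.const_mul d).div
      (((h2.cos.const_mul d).const_sub A).add_const (√(A ^ 2 - d ^ 2))) hden).arctan)).div_const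
        (√(A ^ 2 - d ^ 2))).congr_deriv ?_
    have hv := Real.sin_sq (2 * θ)
    simp only [Pi.div_apply]
    generalize √(A ^ 2 - d ^ 2) = q at *
    generalize Real.sin (2 * θ) = v at *
    generalize Real.cos (2 * θ) = y at *
    have hsum : (A - d * y + q) ^ 2 + d ^ 2 * v ^ 2 ≠ 0 := by positivity
    have hp' := hp.ne'
    have e : 1 + (d * v / (A - d * y + q)) ^ 2 =
        ((A - d * y + q) ^ 2 + d ^ 2 * v ^ 2) / (A - d * y + q) ^ 2 := by
      field_simp
    rw [e]
    simp
    field_simp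
    linear_combination -(A - d * y + q) * (d ^ 2 * hv + hq2)
  rw [intervalIntegral.integral_eq_sub_of_hasDerivAt hderiv]
  · simp [mul_div_cancel₀]
    field_simp
  · exact (Continuous.div (by fun_prop) (by fun_prop) fun θ => (hpos θ).ne').intervalIntegrable _ _

theorem pi_lt_angle {d : ℝ} (hd : d ∈ Set.Ioo (0 : ℝ) (1 / 2)) : Real.pi < angle d := by
  have hd' : d ∈ Set.Ioo (-1 / 2 : ℝ) (1 / 2) := ⟨by linarith [hd.1], hd.2⟩
  obtain ⟨hs, h3, -, h1⟩ := rootMean_facts hd' (y := 1) (by simp)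
  have hd0 := hd.1
  have hint := integral_inv_sub_mul_cos (A := 1 - rootMean d) (d := d)
    (by rw [abs_of_pos hd0]; linarith)
  have hq : 0 < 2 * rootMean d * (2 * rootMean d - 1) := by
    have : 0 < 2 * rootMean d - 1 := by linarith
    positivity
  rw [show (1 - rootMean d) ^ 2 - d ^ 2 = 2 * rootMean d * (2 * rootMean d - 1) by linarith] at hint
  have hpi : Real.pi = ∫ θ in (0 : ℝ)..(Real.pi / 2),
      2 * √(2 * rootMean d * (2 * rootMean d - 1)) *
        (1 / (1 - rootMean d - d * Real.cos (2 * θ))) := by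
    rw [intervalIntegral.integral_const_mul, hint]
    field_simp
  have hu : ∀ θ, 1 - rootMean d - d * Real.cos (2 * θ) = 1 - orbit d θ := fun θ => by
    unfold orbit; ring
  have hlt : ∀ θ, 2 * √(2 * rootMean d * (2 * rootMean d - 1)) *
        (1 / (1 - rootMean d - d * Real.cos (2 * θ))) < angleIntegrand d θ := fun θ => by
    obtain ⟨-, hu0, hu1, -⟩ := orbit_facts hd' θ
    have hm : 0 < 1 - orbit d θ := by linarith
    have hw : 0 < √(orbit d θ + 2 * rootMean d) := by positivity
    have hlt : √(orbit d θ + 2 * rootMean d) < √(2 * rootMean d + 1) :=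
      Real.sqrt_lt_sqrt (by positivity) (by linarith)
    have he : √(rootProduct d) =
        √(2 * rootMean d * (2 * rootMean d - 1)) * √(2 * rootMean d + 1) := by
      rw [← Real.sqrt_mul hq.le, rootProduct]; congr 1; ring
    have hq0 : 0 < √(2 * rootMean d * (2 * rootMean d - 1)) := by positivity
    rw [hu, angleIntegrand, he, mul_one_div, div_lt_div_iff₀ hm
      (mul_pos (by nlinarith) hw)]
    generalize √(2 * rootMean d * (2 * rootMean d - 1)) = q at *
    have : (1 + orbit d θ) * √(orbit d θ + 2 * rootMean d) < 2 * √(2 * rootMean d + 1) := by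
      nlinarith
    nlinarith [mul_lt_mul_of_pos_left this (mul_pos hq0 hm)]
  have hc : Continuous fun θ => 2 * √(2 * rootMean d * (2 * rootMean d - 1)) *
        (1 / (1 - rootMean d - d * Real.cos (2 * θ))) := by
    refine continuous_const.mul (Continuous.div (by fun_prop) (by fun_prop) fun θ => ?_)
    rw [hu]
    linarith [(orbit_facts hd' θ).2.2.1]
  conv_lhs => rw [hpi]
  have hpos := intervalIntegral.intervalIntegral_pos_of_pos
    (((continuous_angleIntegrand hd').sub hc).intervalIntegrable 0 (Real.pi / 2))
    (fun θ => sub_pos.2 (hlt θ)) (by positivity)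
  simp only [Pi.sub_apply] at hpos
  rw [intervalIntegral.integral_sub ((continuous_angleIntegrand hd').intervalIntegrable _ _)
    (hc.intervalIntegrable _ _)] at hpos
  exact sub_pos.1 hpos

/-- Dividing the roots of `x³ - C x + 4` by `√C` turns the difference of the two elliptic
integrals into `angle`. -/
theorem ellipticPi_sub_ellipticPi_eq_angle {a b r : ℝ} (hab : b < a) (hb : 0 < b) (har : a < r)
    (hr : a ^ 2 + a * b + b ^ 2 = r ^ 2) (hprod : a * b * (a + b) = 4) :
    4 / ((a + r) * √(a - -(a + b))) *
        ellipticPi ((a - b) / (a + r)) ((a - b) / (a - -(a + b))) -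
      4 / ((a - r) * √(a - -(a + b))) *
        ellipticPi ((a - b) / (a - r)) ((a - b) / (a - -(a + b))) =
      angle ((a - b) / (2 * r)) := by
  have ha : 0 < a := hb.trans hab
  have hr0 : 0 < r := ha.trans har
  have hmean : rootMean ((a - b) / (2 * r)) = (a + b) / (2 * r) := by
    rw [rootMean, ← Real.sqrt_sq (by positivity : 0 ≤ (a + b) / (2 * r))]
    congr 1
    field_simp
    linarith
  have hx : ∀ θ, b ≤ a - (a - b) * Real.sin θ ^ 2 ∧ a - (a - b) * Real.sin θ ^ 2 ≤ a := fun θ => by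
    have h0 := sq_nonneg (Real.sin θ)
    have h1 := Real.sin_sq_le_one θ
    constructor <;> nlinarith
  have horbit : ∀ θ, orbit ((a - b) / (2 * r)) θ = (a - (a - b) * Real.sin θ ^ 2) / r := fun θ => by
    rw [orbit, hmean, Real.cos_two_mul, Real.cos_sq']
    field_simp
    ring
  have hterm : ∀ q : ℝ, q ≠ 0 → ∀ θ, 4 / (q * √(a - -(a + b))) *
      (1 / ((1 - (a - b) / q * Real.sin θ ^ 2) *
        √(1 - (a - b) / (a - -(a + b)) * Real.sin θ ^ 2))) =
      4 / ((q - (a - b) * Real.sin θ ^ 2) * √(a - (a - b) * Real.sin θ ^ 2 + (a + b))) := by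
    intro q hq θ
    have hac : 0 < a - -(a + b) := by linarith
    rw [show a - (a - b) * Real.sin θ ^ 2 + (a + b) =
      (a - -(a + b)) * (1 - (a - b) / (a - -(a + b)) * Real.sin θ ^ 2) by field_simp; ring,
      Real.sqrt_mul hac.le, show q - (a - b) * Real.sin θ ^ 2 =
        q * (1 - (a - b) / q * Real.sin θ ^ 2) by field_simp]
    rw [div_mul_div_comm]
    congr 1 <;> ring
  have hcont : ∀ q : ℝ, (∀ θ, q - (a - b) * Real.sin θ ^ 2 ≠ 0) → Continuous fun θ =>
      4 / ((q - (a - b) * Real.sin θ ^ 2) * √(a - (a - b) * Real.sin θ ^ 2 + (a + b))) := by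
    intro q hq
    refine Continuous.div (by fun_prop) (by fun_prop) fun θ => mul_ne_zero (hq θ) ?_
    have := (hx θ).1
    exact (Real.sqrt_pos.2 (by linarith)).ne'
  have hplus : ∀ θ, 0 < a + r - (a - b) * Real.sin θ ^ 2 := fun θ => by linarith [(hx θ).1]
  have hminus : ∀ θ, a - r - (a - b) * Real.sin θ ^ 2 < 0 := fun θ => by linarith [(hx θ).2]
  have hproduct : rootProduct ((a - b) / (2 * r)) = 2 ^ 2 / r ^ 3 := by
    rw [rootProduct, hmean]
    field_simp
    linear_combination 4 * (a + b) * hr + 4 * hprod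
  rw [ellipticPi, ellipticPi, ← intervalIntegral.integral_const_mul,
    ← intervalIntegral.integral_const_mul]
  simp only [hterm (a + r) (by linarith), hterm (a - r) (by linarith)]
  rw [← intervalIntegral.integral_sub
    ((hcont _ fun θ => (hplus θ).ne').intervalIntegrable _ _)
    ((hcont _ fun θ => (hminus θ).ne).intervalIntegrable _ _)]
  refine intervalIntegral.integral_congr fun θ _ => ?_
  have hp := hplus θ
  have hm := hminus θ
  have hx0 := (hx θ).1
  simp only [angleIntegrand, horbit, hmean, hproduct]
  generalize (a - b) * Real.sin θ ^ 2 = z at *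
  have hw : √((a - z) / r + 2 * ((a + b) / (2 * r))) = √(a - z + (a + b)) / √r := by
    rw [← Real.sqrt_div (by linarith)]
    congr 1
    field_simp
  have hE : √(2 ^ 2 / r ^ 3) = 2 / (r * √r) := by
    rw [Real.sqrt_div (by positivity), Real.sqrt_sq zero_le_two, pow_succ r 2,
      Real.sqrt_mul (by positivity), Real.sqrt_sq hr0.le]
  rw [hw, hE]
  have hw0 : 0 < √(a - z + (a + b)) := Real.sqrt_pos.2 (by linarith)
  have hrt : 0 < √r := Real.sqrt_pos.2 hr0
  generalize √(a - z + (a + b)) = w at *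
  generalize √r = t at *
  have h1 : a + r - z ≠ 0 := hp.ne'
  have h2 : a - r - z ≠ 0 := hm.ne
  have h3 : 1 - ((a - z) / r) ^ 2 = -((a + r - z) * (a - r - z)) / r ^ 2 := by
    field_simp
    ring
  rw [h3]
  field_simp
  ring

theorem sub_div_mem_Ioo {a b r : ℝ} (hab : b < a) (hb : 0 < b) (har : a < r) :
    (a - b) / (2 * r) ∈ Set.Ioo (0 : ℝ) (1 / 2) := by
  have hr0 : 0 < r := by linarith
  refine ⟨div_pos (by linarith) (by positivity), ?_⟩
  rw [div_lt_div_iff₀ (by positivity) two_pos]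
  linarith

/-- A larger scale `r` makes the roots of `x³ - r² x + 4` relatively further apart. -/
theorem sub_div_lt_sub_div {a b r a' b' r' : ℝ} (hab : b < a) (hb : 0 < b) (hr : 0 < r)
    (hC : a ^ 2 + a * b + b ^ 2 = r ^ 2) (hprod : a * b * (a + b) = 4)
    (hab' : b' < a') (hb' : 0 < b') (hr' : 0 < r')
    (hC' : a' ^ 2 + a' * b' + b' ^ 2 = r' ^ 2) (hprod' : a' * b' * (a' + b') = 4) (hlt : r < r') :
    (a - b) / (2 * r) < (a' - b') / (2 * r') := by
  by_contra! hle
  have key : ∀ {a b r : ℝ}, b < a → 0 < b → 0 < r → a ^ 2 + a * b + b ^ 2 = r ^ 2 →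
      a * b * (a + b) = 4 → 0 ≤ (a - b) / (2 * r) ∧ 0 < (a + b) / (2 * r) ∧
      3 * ((a + b) / (2 * r)) ^ 2 + ((a - b) / (2 * r)) ^ 2 = 1 ∧
      0 < 4 * ((a + b) / (2 * r)) ^ 2 - 1 ∧
      2 * ((a + b) / (2 * r)) * (4 * ((a + b) / (2 * r)) ^ 2 - 1) * r ^ 3 = 4 := by
    intro a b r hab hb hr hC hprod
    have e : 4 * ((a + b) / (2 * r)) ^ 2 - 1 = a * b / r ^ 2 := by
      field_simp
      linear_combination 4 * hC
    refine ⟨div_nonneg (by linarith) (by positivity), div_pos (by linarith) (by positivity),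
      ?_, ?_, ?_⟩
    · field_simp
      linear_combination 4 * hC
    · have : 0 < a := hb.trans hab
      rw [e]; positivity
    · rw [e]
      field_simp
      linear_combination hprod
  obtain ⟨h1, h2, h3, h4, h5⟩ := key hab hb hr hC hprod
  obtain ⟨h1', h2', h3', h4', h5'⟩ := key hab' hb' hr' hC' hprod'
  generalize (a - b) / (2 * r) = d at *
  generalize (a' - b') / (2 * r') = d' at *
  generalize (a + b) / (2 * r) = s at *
  generalize (a' + b') / (2 * r') = s' at *
  have hs2 : s ^ 2 ≤ s' ^ 2 := by nlinarith
  have hs : s ≤ s' := le_of_sq_le_sq hs2 h2'.le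
  have hr3 : r ^ 3 < r' ^ 3 := by gcongr
  have hmono : 2 * s * (4 * s ^ 2 - 1) ≤ 2 * s' * (4 * s' ^ 2 - 1) :=
    mul_le_mul (by linarith) (by linarith) h4.le (by positivity)
  have := mul_lt_mul' hmono hr3 (by positivity) (mul_pos (by positivity) h4')
  linarith

theorem vieta_of_cubic_roots {a b c C : ℝ} (hab : b < a) (hb : 0 < b) (hc : c < 0)
    (ha0 : a ^ 3 - C * a + 4 = 0) (hb0 : b ^ 3 - C * b + 4 = 0) (hc0 : c ^ 3 - C * c + 4 = 0) :
    c = -(a + b) ∧ a ^ 2 + a * b + b ^ 2 = C ∧ a * b * (a + b) = 4 := by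
  have h1 : a ^ 2 + a * b + b ^ 2 = C :=
    mul_left_cancel₀ (sub_ne_zero.2 hab.ne') (by linear_combination ha0 - hb0)
  have h2 : a ^ 2 + a * c + c ^ 2 = C :=
    mul_left_cancel₀ (sub_ne_zero.2 (hc.trans (hb.trans hab)).ne')
      (by linear_combination ha0 - hc0)
  have h3 : c = -(a + b) :=
    mul_left_cancel₀ (sub_ne_zero.2 (hc.trans hb).ne') (by linear_combination h1 - h2)
  exact ⟨h3, h1, by linear_combination a * h1 - ha0⟩

/-- The progression angle `Λ^Θ` is monotonically decreasing in `C₂` on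
`(3·4^(1/3), ∞)`, and `π < Λ^Θ(C₂) < √2·π` there. Here `a C₂ > b C₂ > 0 > c C₂` are
the three distinct real roots of `x³ - C₂x + 4` and `r = √C₂`. -/
theorem stmt14 (a b c : ℝ → ℝ)
    (hroots : ∀ C₂ ∈ Set.Ioi (3 * (4 : ℝ) ^ ((1 : ℝ) / 3)),
      a C₂ > b C₂ ∧ b C₂ > 0 ∧ 0 > c C₂ ∧ Real.sqrt C₂ > a C₂ ∧
      (a C₂) ^ 3 - C₂ * a C₂ + 4 = 0 ∧
      (b C₂) ^ 3 - C₂ * b C₂ + 4 = 0 ∧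
      (c C₂) ^ 3 - C₂ * c C₂ + 4 = 0)
    (Λ : ℝ → ℝ)
    (hΛ : ∀ C₂, Λ C₂ =
      4 / ((a C₂ + Real.sqrt C₂) * Real.sqrt (a C₂ - c C₂)) *
        ellipticPi ((a C₂ - b C₂) / (a C₂ + Real.sqrt C₂))
          ((a C₂ - b C₂) / (a C₂ - c C₂)) -
      4 / ((a C₂ - Real.sqrt C₂) * Real.sqrt (a C₂ - c C₂)) *
        ellipticPi ((a C₂ - b C₂) / (a C₂ - Real.sqrt C₂))
          ((a C₂ - b C₂) / (a C₂ - c C₂))) :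
    StrictAntiOn Λ (Set.Ioi (3 * (4 : ℝ) ^ ((1 : ℝ) / 3))) ∧
    ∀ C₂ ∈ Set.Ioi (3 * (4 : ℝ) ^ ((1 : ℝ) / 3)),
      Real.pi < Λ C₂ ∧ Λ C₂ < Real.sqrt 2 * Real.pi := by
  have hpos : ∀ C ∈ Set.Ioi (3 * (4 : ℝ) ^ ((1 : ℝ) / 3)), 0 < C := fun C hC =>
    lt_trans (by positivity) (Set.mem_Ioi.1 hC)
  have hvieta : ∀ C ∈ Set.Ioi (3 * (4 : ℝ) ^ ((1 : ℝ) / 3)), c C = -(a C + b C) ∧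
      a C ^ 2 + a C * b C + b C ^ 2 = √C ^ 2 ∧ a C * b C * (a C + b C) = 4 := fun C hC => by
    obtain ⟨hab, hb, hc, -, ha0, hb0, hc0⟩ := hroots C hC
    rw [Real.sq_sqrt (hpos C hC).le]
    exact vieta_of_cubic_roots hab hb hc ha0 hb0 hc0
  have hangle : ∀ C ∈ Set.Ioi (3 * (4 : ℝ) ^ ((1 : ℝ) / 3)),
      Λ C = angle ((a C - b C) / (2 * √C)) := fun C hC => by
    obtain ⟨hab, hb, -, har, -⟩ := hroots C hC
    obtain ⟨hc, hr, hprod⟩ := hvieta C hC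
    rw [hΛ, hc]
    exact ellipticPi_sub_ellipticPi_eq_angle hab hb har hr hprod
  have hmem : ∀ C ∈ Set.Ioi (3 * (4 : ℝ) ^ ((1 : ℝ) / 3)),
      (a C - b C) / (2 * √C) ∈ Set.Ioo (0 : ℝ) (1 / 2) := fun C hC => by
    obtain ⟨hab, hb, -, har, -⟩ := hroots C hC
    exact sub_div_mem_Ioo hab hb har
  refine ⟨fun C hC C' hC' hlt => ?_, fun C hC => ?_⟩
  · obtain ⟨hab, hb, -⟩ := hroots C hC
    obtain ⟨hab', hb', -⟩ := hroots C' hC'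
    obtain ⟨-, hr, hprod⟩ := hvieta C hC
    obtain ⟨-, hr', hprod'⟩ := hvieta C' hC'
    rw [hangle C hC, hangle C' hC']
    exact strictAntiOn_angle (Set.Ioo_subset_Ico_self (hmem C hC))
      (Set.Ioo_subset_Ico_self (hmem C' hC'))
      (sub_div_lt_sub_div hab hb (Real.sqrt_pos.2 (hpos C hC)) hr hprod hab' hb'
        (Real.sqrt_pos.2 (hpos C' hC')) hr' hprod' (Real.sqrt_lt_sqrt (hpos C hC).le hlt))
  · rw [hangle C hC]
    refine ⟨pi_lt_angle (hmem C hC), ?_⟩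
    rw [← angle_zero]
    exact strictAntiOn_angle (by norm_num) (Set.Ioo_subset_Ico_self (hmem C hC)) (hmem C hC).1
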